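/- Let (S_i)_{i∈I} be a decomposition of ℝ^{n+1} into simplicial cones with vertices on the unit sphere 𝕊ⁿ, and let p : ℝ^{n+1} → ℝ be a C¹ function that is positively homogeneous of degree d (p(λx) = λ^d p(x) for all λ > 0 and x ∈ ℝ^{n+1}). If for every x ∈ K(p) the origin 0 does not belong to the convex hull of G(p,x), then V and Ṽ are isotopic as subsets of 𝕊ⁿ: there exists a continuous map H : [0,1] × 𝕊ⁿ → 𝕊ⁿ such that for each t the map H(t,·) is a homeomorphism of 𝕊ⁿ onto itself, H(0,·) is the identity, and H(1,·) maps V onto Ṽ. -/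

import Mathlib

open Set Metric RealInnerProductSpace

/-- The simplicial cone generated by a set `A` (intended: a simplex not containing `0`):
`{λ • x : x ∈ A, λ > 0}`. -/
def simplicialCone {n : ℕ} (A : Set (EuclideanSpace ℝ (Fin (n + 1)))) :
    Set (EuclideanSpace ℝ (Fin (n + 1))) :=
  {y | ∃ lam : ℝ, 0 < lam ∧ ∃ x ∈ A, y = lam • x}

open Filter Topology

/-- A bounded Lipschitz vector field on a Banach space generates a global flow. -/
theorem exists_flow_of_lipschitzWith_of_bounded {E : Type*} [NormedAddCommGroup E]
    [NormedSpace ℝ E] [CompleteSpace E] {u : E → E} {K L : NNReal} (hu : LipschitzWith K u)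
    (hL : ∀ x, ‖u x‖ ≤ L) :
    ∃ φ : Flow ℝ E, ∀ x t, HasDerivAt (fun s => φ s x) (u (φ t x)) t := by
  have hpl (N : ℕ) : IsPicardLindelof (fun _ => u)
      (⟨0, by simp⟩ : Icc (-(N : ℝ)) N) 0 (N + L * N) N L K := by
    refine ⟨fun t _ => hu.lipschitzOnWith, fun x _ => continuousOn_const,
      fun t _ x _ => hL x, ?_⟩
    simp
  choose α hα hαc using fun N =>
    (hpl N).exists_forall_mem_closedBall_eq_hasDerivWithinAt_continuousOn
  have hα0 (N : ℕ) (x : E) (hx : ‖x‖ ≤ N) : α N (x, 0) = x := by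
    simpa using (hα N x (by simpa using hx)).1
  have hαd (N : ℕ) (x : E) (hx : ‖x‖ ≤ N) (t : ℝ) (ht : t ∈ Ioo (-(N : ℝ)) N) :
      HasDerivAt (fun s => α N (x, s)) (u (α N (x, t))) t :=
    ((hα N x (by simpa using hx)).2 t (Ioo_subset_Icc_self ht)).hasDerivAt
      (Icc_mem_nhds ht.1 ht.2)
  have huniq (N M : ℕ) (hNM : N ≤ M) (x : E) (hx : ‖x‖ ≤ N) (t : ℝ)
      (ht : t ∈ Ioo (-(N : ℝ)) N) : α N (x, t) = α M (x, t) := by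
    have hNM' : (N : ℝ) ≤ M := by exact_mod_cast hNM
    have h0 : (0 : ℝ) ∈ Ioo (-(N : ℝ)) N := by
      constructor <;> linarith [ht.1, ht.2]
    refine ODE_solution_unique_of_mem_Ioo (v := fun _ => u) (s := fun _ => univ)
      (f := fun s => α N (x, s)) (g := fun s => α M (x, s)) (K := K)
      (fun t _ => hu.lipschitzOnWith) h0 (fun s hs => ⟨hαd N x hx s hs, mem_univ _⟩)
      (fun s hs => ⟨hαd M x (hx.trans hNM') s ⟨?_, ?_⟩, mem_univ _⟩) ?_ ht
    · linarith [hs.1]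
    · linarith [hs.2]
    · simp [hα0 N x hx, hα0 M x (hx.trans hNM')]
  let size : ℝ → E → ℕ := fun t x => ⌈|t|⌉₊ + ⌈‖x‖⌉₊ + 1
  let f : ℝ → E → E := fun t x => α (size t x) (x, t)
  have hsize (t : ℝ) (x : E) : |t| < size t x ∧ ‖x‖ < size t x := by
    have h1 := Nat.le_ceil |t|
    have h2 := Nat.le_ceil ‖x‖
    have h3 : (0 : ℝ) ≤ ⌈|t|⌉₊ := Nat.cast_nonneg _
    have h4 : (0 : ℝ) ≤ ⌈‖x‖⌉₊ := Nat.cast_nonneg _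
    constructor <;> simp only [size] <;> push_cast <;> linarith
  have hf (N : ℕ) (t : ℝ) (x : E) (ht : |t| < N) (hx : ‖x‖ ≤ N) : f t x = α N (x, t) := by
    rcases le_total (size t x) N with h | h
    · exact huniq _ _ h x (hsize t x).2.le t (abs_lt.1 (hsize t x).1)
    · exact (huniq _ _ h x hx t (abs_lt.1 ht)).symm
  have hfd (x : E) (t : ℝ) : HasDerivAt (fun s => f s x) (u (f t x)) t := by
    have h := hsize t x
    rw [hf _ t x h.1 h.2.le]
    refine (hαd _ x h.2.le t (abs_lt.1 h.1)).congr_of_eventuallyEq ?_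
    filter_upwards [continuous_abs.continuousAt.eventually (Iio_mem_nhds h.1)] with s hs
    exact hf _ s x hs h.2.le
  have hf0 (x : E) : f 0 x = x := hα0 _ x (hsize 0 x).2.le
  refine ⟨⟨f, ?_, fun t₁ t₂ x => ?_, hf0⟩, hfd⟩
  · refine continuous_iff_continuousAt.2 fun ⟨t, x⟩ => ?_
    have h := hsize t x
    have h1 : ∀ᶠ q : ℝ × E in 𝓝 (t, x), |q.1| < size t x :=
      (continuous_abs.comp continuous_fst).continuousAt.eventually (Iio_mem_nhds h.1)
    have h2 : ∀ᶠ q : ℝ × E in 𝓝 (t, x), ‖q.2‖ < size t x :=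
      (continuous_norm.comp continuous_snd).continuousAt.eventually (Iio_mem_nhds h.2)
    have hc : ContinuousAt (α (size t x)) (x, t) := by
      refine (hαc (size t x)).continuousAt (prod_mem_nhds ?_ ?_)
      · refine closedBall_mem_nhds_of_mem ?_
        simpa using h.2
      · exact Icc_mem_nhds (abs_lt.1 h.1).1 (abs_lt.1 h.1).2
    have hc' : ContinuousAt (fun q : ℝ × E => α (size t x) (q.2, q.1)) (t, x) :=
      ContinuousAt.comp (f := fun q : ℝ × E => (q.2, q.1)) hc
        (continuous_snd.prodMk continuous_fst).continuousAt
    refine hc'.congr ?_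
    filter_upwards [h1, h2] with q hq1 hq2
    exact (hf _ q.1 q.2 hq1 hq2.le).symm
  · have := ODE_solution_unique_univ (v := fun _ => u) (s := fun _ => univ) (K := K) (t₀ := 0)
      (f := fun s => f (s + t₂) x) (g := fun s => f s (f t₂ x))
      (fun t => hu.lipschitzOnWith)
      (fun t => ⟨(hfd x (t + t₂)).comp_add_const t t₂, mem_univ _⟩)
      (fun t => ⟨hfd _ t, mem_univ _⟩) (by simp [hf0])
    exact congrFun this t₁

namespace Flow

variable {M : Type*} [TopologicalSpace M] {φ : Flow ℝ M} {a b : M → ℝ}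

/-- Along every orbit of the flow, `a` changes sign at most once, from negative to positive. -/
def UpCrossing (φ : Flow ℝ M) (a : M → ℝ) : Prop :=
  ∀ x, 0 ≤ a x → ∀ s, 0 < s → 0 < a (φ s x)

theorem UpCrossing.pos_of_lt (ha : UpCrossing φ a) {y : M} {r s : ℝ} (hr : 0 ≤ a (φ r y))
    (hrs : r < s) : 0 < a (φ s y) := by
  have := ha _ hr (s - r) (sub_pos.2 hrs)
  rwa [← map_add, sub_add_cancel] at this

theorem UpCrossing.neg_of_lt (ha : UpCrossing φ a) {y : M} {r s : ℝ} (hs : a (φ s y) ≤ 0)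
    (hrs : r < s) : a (φ r y) < 0 := by
  by_contra! h
  exact (ha.pos_of_lt h hrs).not_ge hs

theorem UpCrossing.zero_unique (ha : UpCrossing φ a) {y : M} {r s : ℝ} (hr : a (φ r y) = 0)
    (hs : a (φ s y) = 0) : r = s := by
  rcases lt_trichotomy r s with h | h | h
  · exact absurd hs (ha.pos_of_lt hr.ge h).ne'
  · exact h
  · exact absurd hr (ha.pos_of_lt hs.ge h).ne'

/-- The time at which an orbit crosses the zero set of `a`, truncated to `[-c, c]`, is a
continuous function of the starting point. -/
theorem UpCrossing.exists_crossing_time (ha : UpCrossing φ a) (hac : Continuous a) {c : ℝ}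
    (hc : 0 ≤ c) :
    ∃ α : M → ℝ, Continuous α ∧ (∀ y, α y ∈ Icc (-c) c) ∧
      (∀ y, ∀ r ∈ Icc (-c) c, a (φ r y) = 0 → α y = r) ∧
      (∀ y, α y ∈ Ioo (-c) c → a (φ (α y) y) = 0) := by
  let Z : M → Set ℝ := fun y => insert (-c) {r ∈ Icc (-c) c | a (φ r y) < 0}
  have hZc (y : M) : ∀ r ∈ Z y, r ≤ c := by
    rintro r (rfl | hr)
    · linarith
    · exact hr.1.2
  have hbdd (y : M) : BddAbove (Z y) := ⟨c, hZc y⟩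
  have hne (y : M) : (Z y).Nonempty := ⟨-c, mem_insert _ _⟩
  let α : M → ℝ := fun y => sSup (Z y)
  have hαmem (y : M) : α y ∈ Icc (-c) c :=
    ⟨le_csSup (hbdd y) (mem_insert _ _), csSup_le (hne y) (hZc y)⟩
  have horb (y : M) : Continuous fun r => a (φ r y) :=
    hac.comp (φ.continuous continuous_id continuous_const)
  have hlt (y : M) (r : ℝ) (h1 : -c ≤ r) (h2 : r < c) : r < α y ↔ a (φ r y) < 0 := by
    constructor
    · intro h
      obtain ⟨m, hm, hrm⟩ := exists_lt_of_lt_csSup (hne y) h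
      rcases hm with rfl | hm
      · linarith
      · exact ha.neg_of_lt hm.2.le hrm
    · intro h
      have h3 : ∀ᶠ m in 𝓝[>] r, a (φ m y) < 0 :=
        nhdsWithin_le_nhds ((horb y).continuousAt.eventually (Iio_mem_nhds h))
      obtain ⟨m, hm, hrm, hmc⟩ := (h3.and (Ioc_mem_nhdsGT h2)).exists
      exact hrm.trans_le (le_csSup (hbdd y) (Or.inr ⟨⟨by linarith, hmc⟩, hm⟩))
  have hgt (y : M) (r : ℝ) (h1 : -c < r) (h2 : r ≤ c) : α y < r ↔ 0 < a (φ r y) := by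
    constructor
    · intro h
      obtain ⟨m, hm1, hm2⟩ := exists_between h
      have hm3 : 0 ≤ a (φ m y) := by
        by_contra! h'
        exact hm1.not_ge (le_csSup (hbdd y)
          (Or.inr ⟨⟨(hαmem y).1.trans hm1.le, by linarith⟩, h'⟩))
      exact ha.pos_of_lt hm3 hm2
    · intro h
      have h3 : ∀ᶠ m in 𝓝[<] r, 0 < a (φ m y) :=
        nhdsWithin_le_nhds ((horb y).continuousAt.eventually (Ioi_mem_nhds h))
      obtain ⟨m, hm, hmc, hmr⟩ := (h3.and (Ico_mem_nhdsLT h1)).exists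
      refine (csSup_le (hne y) ?_).trans_lt hmr
      rintro k (rfl | hk)
      · exact hmc
      · by_contra! hmk
        exact (ha.pos_of_lt hm.le hmk).not_ge hk.2.le
  refine ⟨α, ?_, hαmem, fun y r hr h0 => ?_, fun y hy => ?_⟩
  · have hopen (r : ℝ) : Continuous fun y => a (φ r y) := hac.comp (φ.continuous_toFun r)
    refine continuous_iff_continuousAt.2 fun y => tendsto_order.2 ⟨fun r hr => ?_, fun r hr => ?_⟩
    · rcases lt_or_ge r (-c) with h | h
      · exact Eventually.of_forall fun z => h.trans_le (hαmem z).1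
      · have h2 : r < c := hr.trans_le (hαmem y).2
        filter_upwards [(hopen r).continuousAt.eventually
          (Iio_mem_nhds ((hlt y r h h2).1 hr))] with z hz
        exact (hlt z r h h2).2 hz
    · rcases lt_or_ge c r with h | h
      · exact Eventually.of_forall fun z => (hαmem z).2.trans_lt h
      · have h2 : -c < r := (hαmem y).1.trans_lt hr
        filter_upwards [(hopen r).continuousAt.eventually
          (Ioi_mem_nhds ((hgt y r h2 h).1 hr))] with z hz
        exact (hgt z r h2 h).2 hz
  · rcases lt_trichotomy (α y) r with h | h | h
    · exact absurd h0 ((hgt y r ((hαmem y).1.trans_lt h) hr.2).1 h).ne'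
    · exact h
    · exact absurd h0 ((hlt y r hr.1 (h.trans_le (hαmem y).2)).1 h).ne
  · refine le_antisymm ?_ ?_
    · by_contra! h
      exact lt_irrefl _ ((hgt y _ hy.1 hy.2.le).2 h)
    · by_contra! h
      exact lt_irrefl _ ((hlt y _ hy.1.le hy.2).2 h)

/-- Moving each point along its orbit by a time which is a contraction along orbits is
bijective. -/
theorem bijective_of_contracting_time (φ : Flow ℝ M) {g : M → ℝ} (hg : Continuous g) {k : ℝ}
    (hk : k < 1) (hgk : ∀ y s, |g (φ s y) - g y| ≤ k * |s|) :
    Function.Bijective fun y => φ (g y) y := by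
  constructor
  · intro y z hyz
    have hz : z = φ (g y - g z) y := by
      have : φ (-g z) (φ (g z) z) = φ (-g z) (φ (g y) y) := by
        rw [show φ (g y) y = φ (g z) z from hyz]
      rw [← map_add, ← map_add, neg_add_cancel, map_zero_apply] at this
      rwa [neg_add_eq_sub] at this
    have h := hgk y (g y - g z)
    rw [← hz, abs_sub_comm] at h
    have h0 : |g y - g z| = 0 := by nlinarith [abs_nonneg (g y - g z)]
    rw [hz, abs_eq_zero.1 h0, map_zero_apply]
  · intro z
    have hcont : Continuous fun s => s + g (φ s z) :=
      continuous_id.add (hg.comp (φ.continuous continuous_id continuous_const))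
    have hk' : 0 < 1 - k := by linarith
    obtain ⟨S, hS0, hS⟩ : ∃ S, 0 ≤ S ∧ |g z| = (1 - k) * S :=
      ⟨|g z| / (1 - k), by positivity, by field_simp⟩
    have hlo : -S + g (φ (-S) z) ≤ 0 := by
      have := abs_le.1 (hgk z (-S))
      rw [abs_neg, abs_of_nonneg hS0] at this
      linarith [le_abs_self (g z)]
    have hhi : 0 ≤ S + g (φ S z) := by
      have := abs_le.1 (hgk z S)
      rw [abs_of_nonneg hS0] at this
      linarith [neg_abs_le (g z)]
    obtain ⟨s, -, hs⟩ := intermediate_value_Icc (by linarith : -S ≤ S) hcont.continuousOn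
      (show (0 : ℝ) ∈ Icc _ _ from ⟨hlo, hhi⟩)
    refine ⟨φ s z, ?_⟩
    change φ (g (φ s z)) (φ s z) = z
    rw [← map_add, add_comm, show s + g (φ s z) = 0 from hs, map_zero_apply]

theorem UpCrossing.reverse (ha : UpCrossing φ a) : UpCrossing φ.reverse (-a) := by
  intro x hx s hs
  have : a (φ (-s) x) < 0 :=
    ha.neg_of_lt (s := 0) (by simpa using hx) (by simpa using hs)
  simpa using this

theorem UpCrossing.exists_uniform_time [CompactSpace M] (hb : UpCrossing φ b)
    (hac : Continuous a) (hbc : Continuous b)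
    (h : ∀ x, a x = 0 → ∃ s, 0 ≤ s ∧ 0 < b (φ s x)) :
    ∃ T₀ : ℝ, ∀ T, T₀ ≤ T → ∀ x, a x = 0 → 0 < b (φ T x) := by
  have hA : IsCompact {x | a x = 0} := (isClosed_eq hac continuous_const).isCompact
  obtain ⟨N, hN⟩ := hA.elim_directed_cover (fun N : ℕ => {x | 0 < b (φ N x)})
    (fun N => isOpen_lt continuous_const (hbc.comp (φ.continuous_toFun N)))
    (fun x hx => by
      obtain ⟨s, -, hs⟩ := h x hx
      obtain ⟨N, hN⟩ := exists_nat_gt s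
      exact mem_iUnion.2 ⟨N, hb.pos_of_lt hs.le hN⟩)
    (Monotone.directed_le fun N N' hNN' x hx => by
      rcases hNN'.eq_or_lt with rfl | h'
      · exact hx
      · exact hb.pos_of_lt (le_of_lt hx) (by exact_mod_cast h'))
  refine ⟨N, fun T hT x hx => ?_⟩
  have hx' : 0 < b (φ N x) := hN hx
  rcases hT.eq_or_lt with rfl | h'
  · exact hx'
  · exact hb.pos_of_lt hx'.le h'

/-- If every orbit which crosses one of the zero sets of `a` and `b` upwards also crosses the other
one, then moving along orbits carries the zero set of `a` isotopically onto that of `b`. -/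
theorem UpCrossing.exists_isotopy [CompactSpace M] (ha : UpCrossing φ a) (hb : UpCrossing φ b)
    (hac : Continuous a) (hbc : Continuous b)
    (hab : ∀ x, a x = 0 → ∃ s, 0 ≤ s ∧ 0 < b (φ s x))
    (hab' : ∀ x, a x = 0 → ∃ s, 0 ≤ s ∧ b (φ (-s) x) < 0)
    (hba : ∀ x, b x = 0 → ∃ s, 0 ≤ s ∧ 0 < a (φ s x))
    (hba' : ∀ x, b x = 0 → ∃ s, 0 ≤ s ∧ a (φ (-s) x) < 0) :
    ∃ g : M → ℝ, Continuous g ∧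
      (∀ t ∈ Icc (0 : ℝ) 1, Function.Bijective fun y => φ (t * g y) y) ∧
      (fun y => φ (g y) y) '' {x | a x = 0} = {x | b x = 0} := by
  obtain ⟨T₁, hT₁⟩ := hb.exists_uniform_time hac hbc hab
  obtain ⟨T₂, hT₂⟩ := hb.reverse.exists_uniform_time hac.neg hbc.neg
    (by simpa using hab')
  obtain ⟨T₃, hT₃⟩ := ha.exists_uniform_time hbc hac hba
  obtain ⟨T₄, hT₄⟩ := ha.reverse.exists_uniform_time hbc.neg hac.neg
    (by simpa using hba')
  obtain ⟨T, hT, hT1, hT2, hT3, hT4⟩ :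
      ∃ T : ℝ, 0 ≤ T ∧ T₁ ≤ T ∧ T₂ ≤ T ∧ T₃ ≤ T ∧ T₄ ≤ T :=
    ⟨max 0 (max T₁ (max T₂ (max T₃ T₄))), by simp⟩
  have cross {a b : M → ℝ} (hbc : Continuous b) (h1 : ∀ x, a x = 0 → 0 < b (φ T x))
      (h2 : ∀ x, a x = 0 → b (φ (-T) x) < 0) {y : M} {r : ℝ} (hr : a (φ r y) = 0) :
      ∃ q, b (φ q y) = 0 ∧ |q - r| ≤ T := by
    have hcont : Continuous fun q => b (φ q y) :=
      hbc.comp (φ.continuous continuous_id continuous_const)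
    have h1' := h1 _ hr
    have h2' := h2 _ hr
    rw [← map_add] at h1' h2'
    obtain ⟨q, hq, hq0⟩ := intermediate_value_Icc (by linarith : -T + r ≤ T + r)
      hcont.continuousOn (show (0 : ℝ) ∈ Icc _ _ from ⟨h2'.le, h1'.le⟩)
    exact ⟨q, hq0, abs_le.2 ⟨by linarith [hq.1], by linarith [hq.2]⟩⟩
  have crossab := @cross a b hbc (hT₁ T hT1)
    (fun x hx => by simpa using hT₂ T hT2 x (by simpa using hx))
  have crossba := @cross b a hac (hT₃ T hT3)
    (fun x hx => by simpa using hT₄ T hT4 x (by simpa using hx))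
  obtain ⟨α, hαc, hαmem, hα, hα'⟩ := ha.exists_crossing_time hac (c := T + 1) (by linarith)
  obtain ⟨β, hβc, -, hβ, -⟩ := hb.exists_crossing_time hbc (c := 2 * T + 1) (by linarith)
  let l : ℝ → ℝ := fun s => max 0 (1 - |s| / (T + 1))
  have hl0 {s : ℝ} (hs : T + 1 ≤ |s|) : l s = 0 := by
    have : 1 ≤ |s| / (T + 1) := (one_le_div (by linarith)).2 hs
    exact max_eq_left (by linarith)
  have hll (s s' : ℝ) : |l s - l s'| ≤ |s - s'| / (T + 1) := by
    have h1 := abs_max_sub_max_le_abs (1 - |s| / (T + 1)) (1 - |s'| / (T + 1)) 0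
    rw [max_comm _ 0, max_comm _ 0] at h1
    refine h1.trans ?_
    rw [show 1 - |s| / (T + 1) - (1 - |s'| / (T + 1)) = (|s'| - |s|) / (T + 1) by ring, abs_div,
      abs_of_nonneg (by linarith : 0 ≤ T + 1), abs_sub_comm s]
    exact div_le_div_of_nonneg_right (abs_abs_sub_abs_le _ _) (by linarith)
  let g : M → ℝ := fun y => (β y - α y) * l (α y)
  have hgc : Continuous g := by fun_prop
  have hα_out (y : M) (h : α y ∉ Ioo (-(T + 1)) (T + 1)) : g y = 0 := by
    have : T + 1 ≤ |α y| := by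
      by_contra! h'
      exact h (abs_lt.1 h')
    simp [g, hl0 this]
  have hg0 (y : M) (h : ∀ r, a (φ r y) ≠ 0) : g y = 0 :=
    hα_out y fun h' => h _ (hα' y h')
  have hg (y : M) (r q : ℝ) (hr : a (φ r y) = 0) (hq : b (φ q y) = 0) :
      |q - r| ≤ T ∧ g y = (q - r) * l r := by
    have hqr : |q - r| ≤ T := by
      obtain ⟨q', hq', h⟩ := crossab hr
      rwa [hb.zero_unique hq hq']
    refine ⟨hqr, ?_⟩
    rcases le_or_gt |r| (T + 1) with h | h
    · have h1 := abs_le.1 h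
      have h2 := abs_le.1 hqr
      simp only [g]
      rw [hα y r h1 hr, hβ y q ⟨by linarith, by linarith⟩ hq]
    · rw [hl0 h.le, mul_zero]
      refine hα_out y fun h' => ?_
      have := ha.zero_unique hr (hα' y h')
      exact h.not_gt (this ▸ abs_lt.2 h')
  have hgk (y : M) (s : ℝ) : |g (φ s y) - g y| ≤ T / (T + 1) * |s| := by
    have hs : 0 ≤ T / (T + 1) * |s| := by positivity
    by_cases h : ∃ r, a (φ r y) = 0
    · obtain ⟨r, hr⟩ := h
      obtain ⟨q, hq, -⟩ := crossab hr
      obtain ⟨hqr, hgy⟩ := hg y r q hr hq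
      obtain ⟨-, hgs⟩ := hg (φ s y) (r - s) (q - s) (by rwa [← map_add, sub_add_cancel])
        (by rwa [← map_add, sub_add_cancel])
      rw [hgy, hgs, sub_sub_sub_cancel_right, ← mul_sub, abs_mul]
      have h3 := hll (r - s) r
      rw [sub_sub_cancel_left, abs_neg] at h3
      calc |q - r| * |l (r - s) - l r| ≤ T * (|s| / (T + 1)) := by gcongr
        _ = _ := by ring
    · push Not at h
      rw [hg0 y h, hg0 (φ s y) fun r => by rw [← map_add]; exact h _]
      simpa using hs
  refine ⟨g, hgc, fun t ht => ?_, ?_⟩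
  · refine bijective_of_contracting_time φ (g := fun y => t * g y) (by fun_prop)
      (k := T / (T + 1)) ((div_lt_one (by linarith)).2 (by linarith)) fun y s => ?_
    rw [← mul_sub, abs_mul, abs_of_nonneg ht.1]
    exact (mul_le_of_le_one_left (abs_nonneg _) ht.2).trans (hgk y s)
  · have hl_zero : l 0 = 1 := by simp [l]
    ext z
    constructor
    · rintro ⟨y, hy, rfl⟩
      have hy' : a (φ 0 y) = 0 := by simpa using hy
      obtain ⟨q, hq, -⟩ := crossab hy'
      have := (hg y 0 q hy' hq).2
      rw [hl_zero, sub_zero, mul_one] at this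
      simpa [this] using hq
    · intro hz
      have hz' : b (φ 0 z) = 0 := by simpa using hz
      obtain ⟨r, hr, -⟩ := crossba hz'
      refine ⟨φ r z, hr, ?_⟩
      have hz'' : b (φ (-r) (φ r z)) = 0 := by
        rwa [← map_add, neg_add_cancel]
      have := (hg (φ r z) 0 (-r) (by simpa using hr) hz'').2
      rw [hl_zero, sub_zero, mul_one] at this
      simp only [this]
      rw [← map_add, neg_add_cancel, map_zero_apply]

end Flow

/-- A continuous function whose zeros are all strict upward crossings changes sign at most once. -/
theorem pos_of_nonneg_of_upward_zeros {f : ℝ → ℝ} (hf : Continuous f)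
    (h : ∀ s, f s = 0 → ∀ᶠ t in 𝓝[≠] s, 0 < slope f s t) {x y : ℝ} (hx : 0 ≤ f x)
    (hxy : x < y) : 0 < f y := by
  have hpos {s t : ℝ} (hs : f s = 0) (hst : s < t) (hsl : 0 < slope f s t) : 0 < f t := by
    rw [slope_def_field, hs, sub_zero] at hsl
    exact (div_pos_iff_of_pos_right (sub_pos.2 hst)).1 hsl
  have hneg {s t : ℝ} (hs : f s = 0) (hst : t < s) (hsl : 0 < slope f s t) : f t < 0 := by
    rw [slope_def_field, hs, sub_zero] at hsl
    by_contra! h'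
    exact hsl.not_ge (div_nonpos_of_nonneg_of_nonpos h' (sub_nonpos.2 hst.le))
  by_contra! hy
  obtain ⟨x', hx', hxy', hfx'⟩ : ∃ x', x ≤ x' ∧ x' < y ∧ 0 < f x' := by
    rcases hx.eq_or_lt with h0 | h0
    · have h1 : ∀ᶠ t in 𝓝[>] x, 0 < slope f x t :=
        nhdsWithin_mono x (fun t ht => ne_of_gt ht) (h x h0.symm)
      obtain ⟨t, ht, htx, hty⟩ := (h1.and (Ioo_mem_nhdsGT hxy)).exists
      exact ⟨t, htx.le, hty, hpos h0.symm htx ht⟩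
    · exact ⟨x, le_rfl, hxy, h0⟩
  let Z := {t ∈ Icc x' y | f t ≤ 0}
  have hZ : IsCompact Z := isCompact_Icc.inter_right (isClosed_le hf continuous_const)
  obtain ⟨z, ⟨hz, hfz⟩, hzmin⟩ := hZ.exists_isLeast ⟨y, ⟨hxy'.le, le_rfl⟩, hy⟩
  have hxz : x' < z := lt_of_le_of_ne hz.1 (by rintro rfl; exact hfx'.not_ge hfz)
  have hbefore : ∀ t ∈ Ioo x' z, 0 < f t := by
    intro t ht
    by_contra! h'
    exact ht.2.not_ge (hzmin ⟨⟨ht.1.le, ht.2.le.trans hz.2⟩, h'⟩)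
  have hfz0 : f z = 0 := by
    have hlim : Tendsto f (𝓝[<] z) (𝓝 (f z)) :=
      hf.continuousAt.tendsto.mono_left nhdsWithin_le_nhds
    refine le_antisymm hfz (ge_of_tendsto hlim ?_)
    filter_upwards [Ioo_mem_nhdsLT hxz] with t ht using (hbefore t ht).le
  have h1 : ∀ᶠ t in 𝓝[<] z, 0 < slope f z t :=
    nhdsWithin_mono z (fun t ht => ne_of_lt ht) (h z hfz0)
  obtain ⟨t, ht, htz⟩ := (h1.and (Ioo_mem_nhdsLT hxz)).exists
  exact (hbefore t htz).not_ge (hneg hfz0 htz.2 ht).le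

/-- A lower bound on the right slopes of a continuous function bounds its growth from below. -/
theorem add_mul_sub_le_of_lt_slope {f : ℝ → ℝ} (hf : Continuous f) {m x y : ℝ} (hxy : x ≤ y)
    (h : ∀ s ∈ Ico x y, ∀ᶠ t in 𝓝[≠] s, m < slope f s t) : f x + m * (y - x) ≤ f y := by
  have := image_le_of_liminf_slope_right_le_deriv_boundary (f := fun t => -f t) (a := x) (b := y)
    (B := fun t => -f x - m * (t - x)) (B' := fun _ => -m) hf.neg.continuousOn (by simp)
    (by fun_prop) (fun s _ => ?_) (fun s hs r hr => ?_) (right_mem_Icc.2 hxy)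
  · linarith
  · have : HasDerivAt (fun t => -f x - m * (t - x)) (-(m * 1)) s :=
      (((hasDerivAt_id s).sub_const x).const_mul m).const_sub (-f x)
    simpa using this.hasDerivWithinAt
  · have h1 : ∀ᶠ t in 𝓝[>] s, m < slope f s t :=
      nhdsWithin_mono s (fun t ht => ne_of_gt ht) (h s hs)
    refine (h1.mono fun t ht => ?_).frequently
    have : slope (fun t => -f t) s t = -slope f s t := by
      simp only [slope_def_field]
      ring
    rw [this]
    linarith

/-- `P` increases at rate more than `c` along every direction close to `z` at `y`. -/
def IncreasesAlong {E : Type*} [AddCommGroup E] [Module ℝ E] [TopologicalSpace E]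
    (P : E → ℝ) (y z : E) (c : ℝ) : Prop :=
  ∀ᶠ q : ℝ × E in 𝓝[≠] 0 ×ˢ 𝓝 z, c < (P (y + q.1 • q.2) - P y) / q.1

section Lift

variable {E : Type*} [NormedAddCommGroup E] [NormedSpace ℝ E]

theorem IncreasesAlong.neg {P : E → ℝ} {y z : E} {c : ℝ} (h : IncreasesAlong P y z c) :
    IncreasesAlong (-P) y (-z) c := by
  have h1 : Tendsto (fun q : ℝ × E => (-q.1, -q.2)) (𝓝[≠] 0 ×ˢ 𝓝 (-z)) (𝓝[≠] 0 ×ˢ 𝓝 z) := by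
    refine Tendsto.prodMk (Tendsto.comp ?_ tendsto_fst) (Tendsto.comp ?_ tendsto_snd)
    · refine tendsto_nhdsWithin_iff.2 ⟨?_, ?_⟩
      · simpa using (continuous_neg.tendsto (0 : ℝ)).mono_left (nhdsWithin_le_nhds (s := {0}ᶜ))
      · filter_upwards [self_mem_nhdsWithin] with s hs
        simpa using hs
    · simpa using continuous_neg.tendsto (-z)
  filter_upwards [h1.eventually h] with q hq
  simp only [neg_smul_neg] at hq
  simp only [Pi.neg_apply]
  convert hq using 1
  rw [div_neg, ← neg_div]
  ring

/-- `γ` is a curve on the unit sphere, and its rescaling by the positive function `ρ` solves the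
equation given by the positively homogeneous extension of the vector field `v`. -/
structure IsHomogeneousLift (v : E → E) (γ : ℝ → E) (ρ : ℝ → ℝ) : Prop where
  norm_eq (t : ℝ) : ‖γ t‖ = 1
  pos (t : ℝ) : 0 < ρ t
  hasDerivAt (t : ℝ) : HasDerivAt (fun s => ρ s • γ s) (ρ t • v (γ t)) t

namespace IsHomogeneousLift

variable {v : E → E} {γ : ℝ → E} {ρ : ℝ → ℝ} {P Q : E → ℝ} {d e : ℕ} {c : ℝ}

theorem reverse (h : IsHomogeneousLift v γ ρ) :
    IsHomogeneousLift (-v) (fun t => γ (-t)) (fun t => ρ (-t)) where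
  norm_eq t := h.norm_eq _
  pos t := h.pos _
  hasDerivAt t := by
    have := (h.hasDerivAt (-t)).scomp t (hasDerivAt_neg t)
    simpa [Function.comp_def] using this

theorem ne_zero (h : IsHomogeneousLift v γ ρ) (t : ℝ) : γ t ≠ 0 := by
  have := h.norm_eq t
  intro h0
  simp [h0] at this

theorem continuous_comp (h : IsHomogeneousLift v γ ρ) (hPc : ContinuousOn P {0}ᶜ) :
    Continuous fun t => P (ρ t • γ t) :=
  hPc.comp_continuous (continuous_iff_continuousAt.2 fun t => (h.hasDerivAt t).continuousAt)
    fun t => smul_ne_zero (h.pos t).ne' (h.ne_zero t)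

theorem lt_slope (h : IsHomogeneousLift v γ ρ)
    (hP : ∀ l : ℝ, 0 < l → ∀ x, x ≠ 0 → P (l • x) = l ^ d * P x) {s : ℝ}
    (hinc : IncreasesAlong P (γ s) (v (γ s)) c) :
    ∀ᶠ t in 𝓝[≠] s, c * ρ s ^ d < slope (fun t => P (ρ t • γ t)) s t := by
  have hρ := h.pos s
  have h1 : Tendsto (fun t => (ρ s)⁻¹ • slope (fun t => ρ t • γ t) s t) (𝓝[≠] s)
      (𝓝 (v (γ s))) := by
    have := (hasDerivAt_iff_tendsto_slope.1 (h.hasDerivAt s)).const_smul (ρ s)⁻¹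
    rwa [inv_smul_smul₀ hρ.ne'] at this
  have h2 : Tendsto (fun t => t - s) (𝓝[≠] s) (𝓝[≠] 0) := by
    refine tendsto_nhdsWithin_iff.2 ⟨?_, ?_⟩
    · have : Tendsto (fun t => t - s) (𝓝 s) (𝓝 (s - s)) :=
        (continuous_id.sub continuous_const).tendsto s
      rw [sub_self] at this
      exact this.mono_left nhdsWithin_le_nhds
    · filter_upwards [self_mem_nhdsWithin] with t ht
      simpa [sub_eq_zero] using ht
  filter_upwards [(h2.prodMk h1).eventually hinc, self_mem_nhdsWithin] with t ht hts
  have hts' : t - s ≠ 0 := sub_ne_zero.2 hts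
  have h3 : γ s + (t - s) • (ρ s)⁻¹ • slope (fun t => ρ t • γ t) s t = (ρ s)⁻¹ • ρ t • γ t := by
    rw [smul_comm, sub_smul_slope, vsub_eq_sub, smul_sub, inv_smul_smul₀ hρ.ne']
    abel
  simp only [h3] at ht
  have h4 : P (ρ t • γ t) = ρ s ^ d * P ((ρ s)⁻¹ • ρ t • γ t) := by
    rw [← hP _ hρ _ (smul_ne_zero (inv_ne_zero hρ.ne')
      (smul_ne_zero (h.pos t).ne' (h.ne_zero t))), smul_inv_smul₀ hρ.ne']
  rw [slope_def_field, h4, hP _ hρ _ (h.ne_zero s), ← mul_sub, mul_div_assoc, mul_comm c]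
  exact mul_lt_mul_of_pos_left ht (pow_pos hρ d)

theorem pos_of_nonneg (h : IsHomogeneousLift v γ ρ) (hPc : ContinuousOn P {0}ᶜ)
    (hP : ∀ l : ℝ, 0 < l → ∀ x, x ≠ 0 → P (l • x) = l ^ d * P x) (hc : 0 < c)
    (hinc : ∀ s, P (γ s) = 0 → IncreasesAlong P (γ s) (v (γ s)) c) {x y : ℝ}
    (hx : 0 ≤ P (γ x)) (hxy : x < y) : 0 < P (γ y) := by
  have hρ (t : ℝ) : 0 < ρ t ^ d := pow_pos (h.pos t) d
  have heq (t : ℝ) : P (ρ t • γ t) = ρ t ^ d * P (γ t) := hP _ (h.pos t) _ (h.ne_zero t)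
  have := pos_of_nonneg_of_upward_zeros (h.continuous_comp hPc) (fun s hs => ?_)
    (x := x) (y := y) (by rw [heq]; exact mul_nonneg (hρ x).le hx) hxy
  · rw [heq] at this
    exact (mul_pos_iff_of_pos_left (hρ y)).1 this
  · rw [heq, mul_eq_zero, or_iff_right (hρ s).ne'] at hs
    filter_upwards [h.lt_slope hP (hinc s hs)] with t ht
    exact (mul_pos hc (hρ s)).trans ht

/-- If a curve starts at a zero of `P` and both `P` and `Q` increase along it wherever their signs
disagree, then `Q` becomes positive along the curve. -/
theorem exists_pos (h : IsHomogeneousLift v γ ρ)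
    (hPc : ContinuousOn P {0}ᶜ) (hQc : ContinuousOn Q {0}ᶜ)
    (hP : ∀ l : ℝ, 0 < l → ∀ x, x ≠ 0 → P (l • x) = l ^ d * P x) (hd : d ≠ 0)
    (hQ : ∀ l : ℝ, 0 < l → ∀ x, x ≠ 0 → Q (l • x) = l ^ e * Q x) (hc : 0 < c)
    {C : ℝ} (hC : ∀ x, ‖x‖ = 1 → P x ≤ C)
    (hPinc : ∀ s, P (γ s) * Q (γ s) ≤ 0 → IncreasesAlong P (γ s) (v (γ s)) c)
    (hQinc : ∀ s, P (γ s) * Q (γ s) ≤ 0 → IncreasesAlong Q (γ s) (v (γ s)) c)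
    (h0 : P (γ 0) = 0) : ∃ s, 0 ≤ s ∧ 0 < Q (γ s) := by
  by_contra! hneg
  have hPpos (t : ℝ) (ht : 0 < t) : 0 < P (γ t) :=
    h.pos_of_nonneg hPc hP hc (fun s hs => hPinc s (by simp [hs])) h0.ge ht
  have hK (t : ℝ) (ht : 1 ≤ t) : P (γ t) * Q (γ t) ≤ 0 :=
    mul_nonpos_of_nonneg_of_nonpos (hPpos t (by linarith)).le (hneg t (by linarith))
  have hPeq (t : ℝ) : P (ρ t • γ t) = ρ t ^ d * P (γ t) := hP _ (h.pos t) _ (h.ne_zero t)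
  have hQeq (t : ℝ) : Q (ρ t • γ t) = ρ t ^ e * Q (γ t) := hQ _ (h.pos t) _ (h.ne_zero t)
  set F := P (ρ 1 • γ 1) with hF
  have hFpos : 0 < F := by
    rw [hF, hPeq]
    exact mul_pos (pow_pos (h.pos 1) d) (hPpos 1 one_pos)
  have hCpos : 0 < C := (hPpos 1 one_pos).trans_le (hC _ (h.norm_eq 1))
  have hFmono (t : ℝ) (ht : 1 ≤ t) : F ≤ P (ρ t • γ t) := by
    have := add_mul_sub_le_of_lt_slope (h.continuous_comp hPc) (m := 0) ht fun s hs => by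
      filter_upwards [h.lt_slope hP (hPinc s (hK s hs.1))] with r hr
      exact (mul_pos hc (pow_pos (h.pos s) d)).trans hr
    simpa using this
  obtain ⟨r, hr0, hr⟩ : ∃ r : ℝ, 0 < r ∧ ∀ t, 1 ≤ t → r ≤ ρ t := by
    refine ⟨min 1 (F / C), lt_min one_pos (div_pos hFpos hCpos), fun t ht => ?_⟩
    rcases le_total 1 (ρ t) with h1 | h1
    · exact (min_le_left _ _).trans h1
    · refine (min_le_right _ _).trans ((div_le_iff₀ hCpos).2 ((hFmono t ht).trans ?_))
      rw [hPeq]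
      exact mul_le_mul (pow_le_of_le_one (h.pos t).le h1 hd) (hC _ (h.norm_eq t))
        (hPpos t (by linarith)).le (h.pos t).le
  have hm : 0 < c * r ^ e := by positivity
  obtain ⟨t, ht1, ht⟩ : ∃ t : ℝ, 1 ≤ t ∧ 0 < Q (ρ 1 • γ 1) + c * r ^ e * (t - 1) := by
    refine ⟨1 + (|Q (ρ 1 • γ 1)| + 1) / (c * r ^ e), ?_, ?_⟩
    · have : 0 ≤ (|Q (ρ 1 • γ 1)| + 1) / (c * r ^ e) := by positivity
      linarith
    · rw [add_sub_cancel_left, mul_div_cancel₀ _ hm.ne']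
      linarith [neg_abs_le (Q (ρ 1 • γ 1))]
  have hgrow := add_mul_sub_le_of_lt_slope (h.continuous_comp hQc) ht1 (m := c * r ^ e)
    fun s hs => by
      filter_upwards [h.lt_slope hQ (hQinc s (hK s hs.1))] with q hq
      refine lt_of_le_of_lt ?_ hq
      gcongr
      exact hr s hs.1
  have hQt : Q (ρ t • γ t) ≤ 0 := by
    rw [hQeq]
    exact mul_nonpos_of_nonneg_of_nonpos (pow_pos (h.pos t) e).le (hneg t (by linarith))
  linarith

end IsHomogeneousLift

end Lift

/-- An integral curve on the sphere of the tangential part of a vector field lifts. -/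
theorem exists_isHomogeneousLift {E : Type*} [NormedAddCommGroup E] [InnerProductSpace ℝ E]
    {v : E → E} (hv : Continuous v) {γ : ℝ → E} (hγ : ∀ t, ‖γ t‖ = 1)
    (hγ' : ∀ t, HasDerivAt γ (v (γ t) - ⟪v (γ t), γ t⟫ • γ t) t) :
    ∃ ρ : ℝ → ℝ, IsHomogeneousLift v γ ρ := by
  have hγc : Continuous γ := continuous_iff_continuousAt.2 fun t => (hγ' t).continuousAt
  have hk : Continuous fun t => ⟪v (γ t), γ t⟫ := (hv.comp hγc).inner hγc
  refine ⟨fun t => Real.exp (∫ s in (0 : ℝ)..t, ⟪v (γ s), γ s⟫), hγ, fun t => Real.exp_pos _,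
    fun t => ?_⟩
  have := (intervalIntegral.integral_hasDerivAt_right (hk.intervalIntegrable 0 t)
    (hk.stronglyMeasurableAtFilter _ _) hk.continuousAt).exp.smul (hγ' t)
  refine this.congr_deriv ?_
  module

/-- If `P` and `Q` are positively homogeneous and both increase along the vector field `v` at all
points of the sphere where their signs disagree, then their zero sets in the sphere are isotopic. -/
theorem exists_isotopy_of_increasesAlong {E : Type*} [NormedAddCommGroup E]
    [InnerProductSpace ℝ E] [FiniteDimensional ℝ E] {v : E → E} (hv : ContDiff ℝ 1 v)
    (hvs : HasCompactSupport v) {P Q : E → ℝ} {d e : ℕ} {c : ℝ}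
    (hPc : ContinuousOn P {0}ᶜ) (hQc : ContinuousOn Q {0}ᶜ)
    (hP : ∀ l : ℝ, 0 < l → ∀ x, x ≠ 0 → P (l • x) = l ^ d * P x) (hd : d ≠ 0)
    (hQ : ∀ l : ℝ, 0 < l → ∀ x, x ≠ 0 → Q (l • x) = l ^ e * Q x) (he : e ≠ 0) (hc : 0 < c)
    (hPinc : ∀ y ∈ sphere (0 : E) 1, P y * Q y ≤ 0 → IncreasesAlong P y (v y) c)
    (hQinc : ∀ y ∈ sphere (0 : E) 1, P y * Q y ≤ 0 → IncreasesAlong Q y (v y) c) :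
    ∃ H : ℝ × E → E, Continuous H ∧
      (∀ t ∈ Icc (0 : ℝ) 1, BijOn (fun x => H (t, x)) (sphere 0 1) (sphere 0 1)) ∧
      (∀ x, H (0, x) = x) ∧
      (fun x => H (1, x)) '' {x ∈ sphere (0 : E) 1 | P x = 0} =
        {x ∈ sphere (0 : E) 1 | Q x = 0} := by
  let u : E → E := fun y => ⟪y, y⟫ • v y - ⟪v y, y⟫ • y
  have hu : ContDiff ℝ 1 u :=
    ((contDiff_id.inner ℝ contDiff_id).smul hv).sub ((hv.inner ℝ contDiff_id).smul contDiff_id)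
  have hus : HasCompactSupport u := by
    refine hvs.mono' fun y hy => ?_
    by_contra h
    exact hy (by simp [u, image_eq_zero_of_notMem_tsupport h])
  obtain ⟨K, hK⟩ := hu.lipschitzWith_of_hasCompactSupport hus one_ne_zero
  obtain ⟨L, hL⟩ := hus.exists_bound_of_continuous hu.continuous
  obtain ⟨φ, hφ⟩ := exists_flow_of_lipschitzWith_of_bounded (L := L.toNNReal) hK
    fun x => (hL x).trans (Real.le_coe_toNNReal L)
  have hinv : IsInvariant φ (sphere (0 : E) 1) := by
    intro t x hx
    have hder (s : ℝ) : HasDerivAt (fun s => ⟪φ s x, φ s x⟫) 0 s := by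
      refine ((hφ x s).inner ℝ (hφ x s)).congr_deriv ?_
      simp only [u, inner_sub_left, inner_sub_right, inner_smul_left, inner_smul_right,
        real_inner_comm (v (φ s x)) (φ s x)]
      simp only [conj_trivial]
      ring
    have hconst := is_const_of_deriv_eq_zero (fun s => (hder s).differentiableAt)
      (fun s => (hder s).deriv) t 0
    rw [φ.map_zero_apply, real_inner_self_eq_norm_sq, real_inner_self_eq_norm_sq,
      mem_sphere_zero_iff_norm.1 hx] at hconst
    rw [mem_sphere_zero_iff_norm]
    exact (pow_eq_one_iff_of_nonneg (norm_nonneg _) two_ne_zero).1 (by simpa using hconst)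
  let ψ : Flow ℝ (sphere (0 : E) 1) := φ.restrict hinv
  have hψ (t : ℝ) (x : sphere (0 : E) 1) : (ψ t x : E) = φ t x := rfl
  let a : sphere (0 : E) 1 → ℝ := fun x => P x
  let b : sphere (0 : E) 1 → ℝ := fun x => Q x
  have hsub (x : sphere (0 : E) 1) : (x : E) ∈ ({0}ᶜ : Set E) := ne_zero_of_mem_unit_sphere x
  have hac : Continuous a := hPc.comp_continuous continuous_subtype_val hsub
  have hbc : Continuous b := hQc.comp_continuous continuous_subtype_val hsub
  have hlift (x : sphere (0 : E) 1) : ∃ ρ : ℝ → ℝ, IsHomogeneousLift v (fun t => (ψ t x : E)) ρ := by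
    refine exists_isHomogeneousLift hv.continuous (fun t => by simp) fun t => ?_
    have h1 : ⟪(ψ t x : E), (ψ t x : E)⟫ = (1 : ℝ) := by
      rw [real_inner_self_eq_norm_sq]
      simp
    refine (hφ x t).congr_deriv ?_
    simp only [u, ← hψ, h1, one_smul]
  have hb_bound {R : E → ℝ} (hR : Continuous fun x : sphere (0 : E) 1 => R x) :
      ∃ C : ℝ, ∀ x : E, ‖x‖ = 1 → |R x| ≤ C := by
    obtain ⟨C, hC⟩ := (isCompact_univ (X := sphere (0 : E) 1)).exists_bound_of_continuousOn
      hR.continuousOn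
    exact ⟨C, fun x hx => hC ⟨x, by simpa using hx⟩ (mem_univ _)⟩
  obtain ⟨CP, hCP⟩ := hb_bound hac
  obtain ⟨CQ, hCQ⟩ := hb_bound hbc
  have hup {R : E → ℝ} {k : ℕ} (hRc : ContinuousOn R {0}ᶜ)
      (hR : ∀ l : ℝ, 0 < l → ∀ x, x ≠ 0 → R (l • x) = l ^ k * R x)
      (hinc : ∀ y ∈ sphere (0 : E) 1, R y = 0 → IncreasesAlong R y (v y) c) :
      ψ.UpCrossing fun x => R x := by
    intro x hx s hs
    obtain ⟨ρ, hρ⟩ := hlift x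
    exact hρ.pos_of_nonneg hRc hR hc (fun t => hinc _ (ψ t x).2) (x := 0)
      (by simpa using hx) hs
  have hPnc : ContinuousOn (-P) {0}ᶜ := hPc.neg
  have hQnc : ContinuousOn (-Q) {0}ᶜ := hQc.neg
  have hPn : ∀ l : ℝ, 0 < l → ∀ x, x ≠ 0 → (-P) (l • x) = l ^ d * (-P) x :=
    fun l hl x hx => by simp [hP l hl x hx]
  have hQn : ∀ l : ℝ, 0 < l → ∀ x, x ≠ 0 → (-Q) (l • x) = l ^ e * (-Q) x :=
    fun l hl x hx => by simp [hQ l hl x hx]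
  obtain ⟨g, hg, hbij, himg⟩ := Flow.UpCrossing.exists_isotopy (φ := ψ) (a := a) (b := b)
    (hup hPc hP fun y hy h0 => hPinc y hy (by simp [h0]))
    (hup hQc hQ fun y hy h0 => hQinc y hy (by simp [h0])) hac hbc
    (fun x hx => by
      obtain ⟨ρ, hρ⟩ := hlift x
      exact hρ.exists_pos hPc hQc hP hd hQ hc (fun y hy => (abs_le.1 (hCP y hy)).2)
        (fun s => hPinc _ (ψ s x).2) (fun s => hQinc _ (ψ s x).2) (by simpa using hx))
    (fun x hx => by
      obtain ⟨ρ, hρ⟩ := hlift x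
      simpa using hρ.reverse.exists_pos hPnc hQnc hPn hd hQn hc
        (fun y hy => neg_le.1 (abs_le.1 (hCP y hy)).1)
        (fun s hs => (hPinc _ (ψ (-s) x).2 (by simpa using hs)).neg)
        (fun s hs => (hQinc _ (ψ (-s) x).2 (by simpa using hs)).neg) (by simpa using hx))
    (fun x hx => by
      obtain ⟨ρ, hρ⟩ := hlift x
      exact hρ.exists_pos hQc hPc hQ he hP hc (fun y hy => (abs_le.1 (hCQ y hy)).2)
        (fun s hs => hQinc _ (ψ s x).2 (by rwa [mul_comm]))
        (fun s hs => hPinc _ (ψ s x).2 (by rwa [mul_comm])) (by simpa using hx))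
    (fun x hx => by
      obtain ⟨ρ, hρ⟩ := hlift x
      simpa using hρ.reverse.exists_pos hQnc hPnc hQn he hPn hc
        (fun y hy => neg_le.1 (abs_le.1 (hCQ y hy)).1)
        (fun s hs => (hQinc _ (ψ (-s) x).2 (by simpa [mul_comm] using hs)).neg)
        (fun s hs => (hPinc _ (ψ (-s) x).2 (by simpa [mul_comm] using hs)).neg)
        (by simpa using hx))
  obtain ⟨G, hG⟩ := ContinuousMap.exists_restrict_eq (isClosed_sphere (x := (0 : E)) (ε := 1))
    ⟨g, hg⟩
  have hG' (x : sphere (0 : E) 1) : G x = g x := congrArg (fun f => f x) hG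
  have hcoe (t : ℝ) (x : sphere (0 : E) 1) : φ (t * G x) x = ψ (t * g x) x := by
    rw [hψ, hG']
  refine ⟨fun q => φ (q.1 * G q.2) q.2, φ.continuous (by fun_prop) continuous_snd,
    fun t ht => ⟨fun x hx => hinv _ hx, fun x hx y hy hxy => ?_, fun z hz => ?_⟩,
    fun x => by simp, ?_⟩
  · have := (hbij t ht).1 (a₁ := ⟨x, hx⟩) (a₂ := ⟨y, hy⟩)
      (Subtype.ext ((hcoe t ⟨x, hx⟩).symm.trans (hxy.trans (hcoe t ⟨y, hy⟩))))
    exact congrArg Subtype.val this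
  · obtain ⟨y, hy⟩ := (hbij t ht).2 ⟨z, hz⟩
    exact ⟨y, y.2, (hcoe t y).trans (congrArg Subtype.val hy)⟩
  · ext z
    constructor
    · rintro ⟨x, ⟨hx, hx0⟩, rfl⟩
      have : ψ (g ⟨x, hx⟩) ⟨x, hx⟩ ∈ {x | b x = 0} := himg ▸ mem_image_of_mem _ hx0
      refine ⟨hinv _ hx, ?_⟩
      have h1 := hcoe 1 ⟨x, hx⟩
      simp only [one_mul] at h1 ⊢
      rw [h1]
      exact this
    · rintro ⟨hz, hz0⟩
      have : (⟨z, hz⟩ : sphere (0 : E) 1) ∈ {x | b x = 0} := hz0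
      rw [← himg] at this
      obtain ⟨y, hy, hyz⟩ := this
      refine ⟨y, ⟨y.2, hy⟩, ?_⟩
      have h1 := hcoe 1 y
      simp only [one_mul] at h1 ⊢
      rw [h1]
      exact congrArg Subtype.val hyz

/-- The cone over a compact set that avoids the origin is closed away from the origin. -/
theorem eventually_mem_simplicialCone_imp {n : ℕ} {A : Set (EuclideanSpace ℝ (Fin (n + 1)))}
    (hA : IsCompact A) (h0 : 0 ∉ A) {x : EuclideanSpace ℝ (Fin (n + 1))} (hx : x ≠ 0) :
    ∀ᶠ y in 𝓝 x, y ∈ simplicialCone A → x ∈ simplicialCone A := by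
  by_cases hxA : x ∈ simplicialCone A
  · exact Eventually.of_forall fun _ _ => hxA
  have hne : ∀ a ∈ A, a ≠ 0 := fun a ha h => h0 (h ▸ ha)
  have hN : IsCompact ((fun a => ‖a‖⁻¹ • a) '' A) :=
    hA.image_of_continuousOn fun a ha =>
      (((continuous_norm.continuousAt.inv₀ (norm_ne_zero_iff.2 (hne a ha))).smul
        continuousAt_id)).continuousWithinAt
  have hcont : ContinuousAt (fun y : EuclideanSpace ℝ (Fin (n + 1)) => ‖y‖⁻¹ • y) x :=
    (continuous_norm.continuousAt.inv₀ (norm_ne_zero_iff.2 hx)).smul continuousAt_id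
  have hxN : ‖x‖⁻¹ • x ∈ ((fun a => ‖a‖⁻¹ • a) '' A)ᶜ := by
    rintro ⟨a, ha, h⟩
    have ha' := norm_pos_iff.2 (hne a ha)
    have hx' := norm_pos_iff.2 hx
    refine hxA ⟨‖x‖ * ‖a‖⁻¹, by positivity, a, ha, ?_⟩
    simp only at h
    rw [mul_smul, h, smul_smul, mul_inv_cancel₀ hx'.ne', one_smul]
  filter_upwards [hcont.eventually (hN.isClosed.isOpen_compl.mem_nhds hxN)] with y hy hyA
  obtain ⟨l, hl, a, ha, rfl⟩ := hyA
  refine absurd ⟨a, ha, ?_⟩ hy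
  have := (norm_pos_iff.2 (hne a ha)).ne'
  simp only [norm_smul, Real.norm_eq_abs, abs_of_pos hl, smul_smul]
  congr 1
  field_simp

theorem smul_mem_simplicialCone {n : ℕ} {A : Set (EuclideanSpace ℝ (Fin (n + 1)))}
    {x : EuclideanSpace ℝ (Fin (n + 1))} (hx : x ∈ simplicialCone A) {l : ℝ} (hl : 0 < l) :
    l • x ∈ simplicialCone A := by
  obtain ⟨m, hm, a, ha, rfl⟩ := hx
  exact ⟨l * m, mul_pos hl hm, a, ha, smul_smul _ _ _⟩

section PiecewiseLinear

variable {E ι : Type*} [NormedAddCommGroup E] [InnerProductSpace ℝ E] [Finite ι]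
  {S : ι → Set E} {f : E → ℝ} {w : ι → E} {x : E}

/-- A piecewise linear function is continuous. -/
theorem continuousAt_of_piecewise_linear
    (hcover : ∀ᶠ y in 𝓝 x, ∃ i, y ∈ S i) (hS : ∀ i, ∀ᶠ y in 𝓝 x, y ∈ S i → x ∈ S i)
    (hlin : ∀ i, ∀ y ∈ S i, f y = ⟪w i, y⟫) : ContinuousAt f x := by
  refine Metric.tendsto_nhds.2 fun ε hε => ?_
  have h : ∀ i, ∀ᶠ y in 𝓝 x, |⟪w i, y⟫ - ⟪w i, x⟫| < ε := fun i =>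
    Metric.tendsto_nhds.1 (continuous_const.inner continuous_id :
      Continuous fun y => ⟪w i, y⟫).continuousAt ε hε
  filter_upwards [hcover, eventually_all.2 hS, eventually_all.2 h] with y ⟨i, hi⟩ hSy hy
  rw [Real.dist_eq, hlin i y hi, hlin i x (hSy i hi)]
  exact hy i

/-- A piecewise linear function increases along every vector on which all the active gradients
are large. -/
theorem increasesAlong_of_piecewise_linear
    (hcover : ∀ᶠ y in 𝓝 x, ∃ i, y ∈ S i) (hS : ∀ i, ∀ᶠ y in 𝓝 x, y ∈ S i → x ∈ S i)
    (hlin : ∀ i, ∀ y ∈ S i, f y = ⟪w i, y⟫) {z : E} {c : ℝ}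
    (hz : ∀ i, x ∈ S i → c < ⟪w i, z⟫) : IncreasesAlong f x z c := by
  have hsnd : Tendsto (fun q : ℝ × E => q.2) (𝓝[≠] 0 ×ˢ 𝓝 z) (𝓝 z) := tendsto_snd
  have hfst : Tendsto (fun q : ℝ × E => q.1) (𝓝[≠] 0 ×ˢ 𝓝 z) (𝓝 0) :=
    tendsto_fst.mono_right nhdsWithin_le_nhds
  have hpt : Tendsto (fun q : ℝ × E => x + q.1 • q.2) (𝓝[≠] 0 ×ˢ 𝓝 z) (𝓝 x) := by
    simpa using (hfst.smul hsnd).const_add x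
  have hne : ∀ᶠ q : ℝ × E in 𝓝[≠] 0 ×ˢ 𝓝 z, q.1 ≠ 0 :=
    tendsto_fst.eventually eventually_mem_nhdsWithin
  have hw : ∀ i, ∀ᶠ q : ℝ × E in 𝓝[≠] 0 ×ˢ 𝓝 z, x ∈ S i → c < ⟪w i, q.2⟫ := fun i => by
    by_cases hi : x ∈ S i
    · filter_upwards [(tendsto_const_nhds.inner hsnd).eventually_const_lt (hz i hi)] with q hq _
      exact hq
    · exact Eventually.of_forall fun _ h => absurd h hi
  filter_upwards [hne, hpt.eventually hcover, hpt.eventually (eventually_all.2 hS),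
    eventually_all.2 hw] with q hq ⟨i, hi⟩ hSq hwq
  rw [hlin i _ hi, hlin i x (hSq i hi), inner_add_right, inner_smul_right, add_sub_cancel_left,
    mul_div_cancel_left₀ _ hq]
  exact hwq i (hSq i hi)

end PiecewiseLinear

/-- A differentiable function increases along every vector on which its gradient is large. -/
theorem HasGradientAt.increasesAlong {E : Type*} [NormedAddCommGroup E] [InnerProductSpace ℝ E]
    [CompleteSpace E] {f : E → ℝ} {g x z : E} {c : ℝ} (hf : HasGradientAt f g x)
    (hz : c < ⟪g, z⟫) : IncreasesAlong f x z c := by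
  have hsnd : Tendsto (fun q : ℝ × E => q.2) (𝓝[≠] 0 ×ˢ 𝓝 z) (𝓝 z) := tendsto_snd
  have hfst : Tendsto (fun q : ℝ × E => q.1) (𝓝[≠] 0 ×ˢ 𝓝 z) (𝓝 0) :=
    tendsto_fst.mono_right nhdsWithin_le_nhds
  have hne : ∀ᶠ q : ℝ × E in 𝓝[≠] 0 ×ˢ 𝓝 z, q.1 ≠ 0 :=
    tendsto_fst.eventually eventually_mem_nhdsWithin
  have hlim := hf.hasFDerivAt.hasFDerivWithinAt (s := univ).lim
    (c := fun q : ℝ × E => q.1⁻¹) (d := fun q => q.1 • q.2)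
    (by simpa using hfst.smul hsnd) (Eventually.of_forall fun _ => mem_univ _)
    (hsnd.congr' (hne.mono fun q hq => (inv_smul_smul₀ hq _).symm))
  filter_upwards [hlim.eventually_const_lt (by simpa using hz)] with q hq
  rwa [smul_eq_mul, inv_mul_eq_div] at hq

/-- A finite set whose convex hull avoids the origin lies strictly on one side of a hyperplane. -/
theorem exists_forall_one_lt_inner {E : Type*} [NormedAddCommGroup E] [InnerProductSpace ℝ E]
    [CompleteSpace E] {G : Set E} (hG : G.Finite) (h0 : (0 : E) ∉ convexHull ℝ G) :
    ∃ v : E, ∀ g ∈ G, 1 < ⟪g, v⟫ := by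
  obtain ⟨f, u, hu, hf⟩ := geometric_hahn_banach_point_closed (convex_convexHull ℝ G)
    (hG.isCompact_convexHull (𝕜 := ℝ)).isClosed h0
  rw [map_zero] at hu
  refine ⟨u⁻¹ • (InnerProductSpace.toDual ℝ E).symm f, fun g hg => ?_⟩
  rw [inner_smul_right, real_inner_comm, InnerProductSpace.toDual_symm_apply, inv_mul_eq_div,
    one_lt_div hu]
  exact hf g (subset_convexHull ℝ G hg)

open scoped Manifold ContDiff in
/-- A pointwise convex open condition on a compact set, locally solvable by constants, is solved by
a compactly supported `C¹` vector field. -/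
theorem exists_contDiff_hasCompactSupport_forall_mem {E : Type*} [NormedAddCommGroup E]
    [InnerProductSpace ℝ E] [FiniteDimensional ℝ E] {K : Set E} (hK : IsCompact K)
    {t : E → Set E} (ht : ∀ x ∈ K, Convex ℝ (t x))
    (hloc : ∀ x ∈ K, ∃ c, ∀ᶠ y in 𝓝 x, y ∈ K → c ∈ t y) :
    ∃ v : E → E, ContDiff ℝ 1 v ∧ HasCompactSupport v ∧ ∀ x ∈ K, v x ∈ t x := by
  obtain ⟨g, hg⟩ := exists_contMDiffMap_forall_mem_convex_of_local_const (n := 1) 𝓘(ℝ, E)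
    (t := fun x => {v : E | x ∈ K → v ∈ t x})
    (fun x a ha b hb l m hl hm hlm hx => ht x hx (ha hx) (hb hx) hl hm hlm)
    (fun x => by
      by_cases hx : x ∈ K
      · exact hloc x hx
      · exact ⟨0, (hK.isClosed.isOpen_compl.eventually_mem hx).mono fun y hy h => absurd h hy⟩)
  obtain ⟨R, hR⟩ := hK.isBounded.subset_closedBall (0 : E)
  let b : ContDiffBump (0 : E) := ⟨max R 1, max R 1 + 1, by positivity, by linarith⟩
  refine ⟨fun x => b x • g x, b.contDiff.smul g.contMDiff.contDiff,
    b.hasCompactSupport.smul_right, fun x hx => ?_⟩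
  have hb : b x = 1 := b.one_of_mem_closedBall
    (closedBall_subset_closedBall (le_max_left _ _) (hR hx))
  simpa only [hb, one_smul] using hg x hx

/-- **Theorem 3** (codimension one, on the sphere). Let `(S i)_{i ∈ ι}` be a decomposition
of `ℝ^{n+1}` into simplicial cones with vertices on the unit sphere `𝕊ⁿ` (each `S i` is the
cone over the convex hull of a finite affinely independent vertex set lying on `𝕊ⁿ`, whose
convex hull avoids `0`; the cones cover `ℝ^{n+1} \ {0}`, pairwise intersections are common
faces which are simplicial cones of dimension at most `n`, and interiors are disjoint).
Let `p : ℝ^{n+1} → ℝ` be `C¹` and positively homogeneous of degree `d`, let `ptilde` be the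
piecewise linear interpolant of `p` (linear with gradient `w i` on `S i` and agreeing with
`p` at the vertices), and put `V = {x ∈ 𝕊ⁿ | p x = 0}`, `Ṽ = {x ∈ 𝕊ⁿ | ptilde x = 0}`,
`K(p) = {x ∈ 𝕊ⁿ | p x * ptilde x ≤ 0}`, `∇̃p(x) = {w i : x ∈ S i}` and
`G(p, x) = {∇p(x)} ∪ ∇̃p(x)`. If `0 ∉ 𝓗(G(p, x))` for all `x ∈ K(p)`, then `V` and `Ṽ`
are isotopic as subsets of `𝕊ⁿ`: there is a continuous `H : [0,1] × 𝕊ⁿ → 𝕊ⁿ` with each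
`H (t, ·)` a homeomorphism of `𝕊ⁿ` onto itself (a continuous bijection of the compact
sphere onto itself), `H (0, ·) = id` and `H (1, ·) '' V = Ṽ`. -/
theorem isotopy_of_piecewise_linear_approximation_sphere
    {n : ℕ} {ι : Type*} [Fintype ι]
    (verts : ι → Finset (EuclideanSpace ℝ (Fin (n + 1))))
    (hsphere : ∀ i, ∀ v ∈ verts i, v ∈ sphere (0 : EuclideanSpace ℝ (Fin (n + 1))) 1)
    (hindep : ∀ i, AffineIndependent ℝ
      (fun v : (verts i : Set (EuclideanSpace ℝ (Fin (n + 1)))) =>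
        (v : EuclideanSpace ℝ (Fin (n + 1)))))
    (hzero : ∀ i, (0 : EuclideanSpace ℝ (Fin (n + 1))) ∉
      convexHull ℝ (verts i : Set (EuclideanSpace ℝ (Fin (n + 1)))))
    (S : ι → Set (EuclideanSpace ℝ (Fin (n + 1))))
    (hS : ∀ i, S i = simplicialCone
      (convexHull ℝ (verts i : Set (EuclideanSpace ℝ (Fin (n + 1))))))
    (hcover : ⋃ i, S i = {(0 : EuclideanSpace ℝ (Fin (n + 1)))}ᶜ)
    (hface : ∀ i j, i ≠ j → ∃ F : Finset (EuclideanSpace ℝ (Fin (n + 1))),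
      F ⊆ verts i ∧ F ⊆ verts j ∧ F.card ≤ n ∧
      S i ∩ S j = simplicialCone
        (convexHull ℝ (F : Set (EuclideanSpace ℝ (Fin (n + 1))))))
    (hdisj : ∀ i j, i ≠ j → interior (S i) ∩ interior (S j) = ∅)
    (d : ℕ) (p : EuclideanSpace ℝ (Fin (n + 1)) → ℝ) (hp : ContDiff ℝ 1 p)
    (hhom : ∀ lam : ℝ, 0 < lam → ∀ x, p (lam • x) = lam ^ d * p x)
    (ptilde : EuclideanSpace ℝ (Fin (n + 1)) → ℝ)
    (w : ι → EuclideanSpace ℝ (Fin (n + 1)))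
    (hlin : ∀ i, ∀ x ∈ S i, ptilde x = ⟪w i, x⟫)
    (hinterp : ∀ i, ∀ v ∈ verts i, ptilde v = p v)
    (V : Set (EuclideanSpace ℝ (Fin (n + 1))))
    (hV : V = {x ∈ sphere (0 : EuclideanSpace ℝ (Fin (n + 1))) 1 | p x = 0})
    (Vt : Set (EuclideanSpace ℝ (Fin (n + 1))))
    (hVt : Vt = {x ∈ sphere (0 : EuclideanSpace ℝ (Fin (n + 1))) 1 | ptilde x = 0})
    (hcond : ∀ x ∈ {x ∈ sphere (0 : EuclideanSpace ℝ (Fin (n + 1))) 1 |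
        p x * ptilde x ≤ 0},
      (0 : EuclideanSpace ℝ (Fin (n + 1))) ∉ convexHull ℝ
        (insert (gradient p x) {g | ∃ i, x ∈ S i ∧ g = w i})) :
    ∃ H : ℝ × EuclideanSpace ℝ (Fin (n + 1)) → EuclideanSpace ℝ (Fin (n + 1)),
      ContinuousOn H (Icc (0 : ℝ) 1 ×ˢ sphere (0 : EuclideanSpace ℝ (Fin (n + 1))) 1) ∧
      (∀ t ∈ Icc (0 : ℝ) 1, BijOn (fun x => H (t, x))
        (sphere (0 : EuclideanSpace ℝ (Fin (n + 1))) 1)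
        (sphere (0 : EuclideanSpace ℝ (Fin (n + 1))) 1)) ∧
      (∀ x ∈ sphere (0 : EuclideanSpace ℝ (Fin (n + 1))) 1, H (0, x) = x) ∧
      (fun x => H (1, x)) '' V = Vt := by
  have hScl : ∀ x, x ≠ 0 → ∀ i, ∀ᶠ y in 𝓝 x, y ∈ S i → x ∈ S i := fun x hx i => by
    simp only [hS]
    exact eventually_mem_simplicialCone_imp
      ((verts i).finite_toSet.isCompact_convexHull (𝕜 := ℝ)) (hzero i) hx
  have hSmem : ∀ x, x ≠ 0 → ∃ i, x ∈ S i := fun x hx =>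
    mem_iUnion.1 (hcover ▸ (mem_compl_singleton_iff.2 hx : x ∈ _))
  have hSnhds : ∀ x, x ≠ 0 → ∀ᶠ y in 𝓝 x, ∃ i, y ∈ S i := fun x hx =>
    (isOpen_ne.eventually_mem hx).mono hSmem
  have hne : ∀ x ∈ sphere (0 : EuclideanSpace ℝ (Fin (n + 1))) 1, x ≠ 0 := fun x hx =>
    ne_of_mem_sphere hx one_ne_zero
  obtain rfl | hd := eq_or_ne d 0
  · have hconst : ∀ x, p x = p 0 := fun x => by
      have h1 : Tendsto (fun l : ℝ => p (l • x)) (𝓝[>] 0) (𝓝 (p 0)) := by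
        have : Continuous fun l : ℝ => p (l • x) := hp.continuous.comp (by fun_prop)
        simpa using (this.tendsto 0).mono_left nhdsWithin_le_nhds
      refine tendsto_nhds_unique (tendsto_const_nhds.congr' ?_) h1
      filter_upwards [self_mem_nhdsWithin] with l hl
      simp [hhom l hl]
    obtain ⟨x₀, hx₀⟩ := (NormedSpace.sphere_nonempty (x := (0 : EuclideanSpace ℝ (Fin (n + 1))))
      (r := 1)).2 zero_le_one
    have hp0 : p 0 ≠ 0 := fun h => by
      refine hcond x₀ ⟨hx₀, by simp [hconst x₀, h]⟩ (subset_convexHull ℝ _ (Or.inl ?_))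
      rw [funext hconst, gradient_fun_const]
    have hpt : ∀ x, x ≠ 0 → ptilde x ≠ 0 := fun x hx => by
      obtain ⟨i, hi⟩ := hSmem x hx
      rw [hlin i x hi]
      rw [hS] at hi
      obtain ⟨l, hl, a, ha, rfl⟩ := hi
      have hsub : convexHull ℝ (verts i : Set (EuclideanSpace ℝ (Fin (n + 1)))) ⊆
          {a | ⟪w i, a⟫ = p 0} := by
        refine convexHull_min (fun v hv => ?_)
          (convex_hyperplane (innerSL ℝ (w i)).toLinearMap.isLinear _)
        have hvS : v ∈ S i := by
          rw [hS]
          exact ⟨1, one_pos, v, subset_convexHull ℝ _ hv, (one_smul _ _).symm⟩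
        exact (hlin i v hvS).symm.trans ((hinterp i v hv).trans (hconst v))
      rw [inner_smul_right, hsub ha]
      exact mul_ne_zero hl.ne' hp0
    have hVe : V = ∅ := hV ▸ eq_empty_of_forall_notMem fun x hx => hp0 (hconst x ▸ hx.2)
    have hVte : Vt = ∅ := hVt ▸ eq_empty_of_forall_notMem fun x hx => hpt x (hne x hx.1) hx.2
    exact ⟨Prod.snd, continuous_snd.continuousOn, fun _ _ => bijOn_id _, fun _ _ => rfl, by
      rw [hVe, hVte, image_empty]⟩
  have hptc : ContinuousOn ptilde {0}ᶜ := fun x hx =>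
    (continuousAt_of_piecewise_linear (hSnhds x hx) (hScl x hx) hlin).continuousWithinAt
  have hpthom : ∀ l : ℝ, 0 < l → ∀ x, x ≠ 0 → ptilde (l • x) = l ^ 1 * ptilde x :=
    fun l hl x hx => by
      obtain ⟨i, hi⟩ := hSmem x hx
      have hli : l • x ∈ S i := by
        rw [hS] at hi ⊢
        exact smul_mem_simplicialCone hi hl
      rw [hlin i _ hli, hlin i x hi, inner_smul_right, pow_one]
  have hgrad : Continuous (gradient p) :=
    (InnerProductSpace.toDual ℝ _).symm.continuous.comp (hp.continuous_fderiv one_ne_zero)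
  have hK : IsCompact {x ∈ sphere (0 : EuclideanSpace ℝ (Fin (n + 1))) 1 |
      p x * ptilde x ≤ 0} :=
    (isCompact_sphere _ _).of_isClosed_subset
      ((hp.continuous.continuousOn.mul (hptc.mono hne)).preimage_isClosed_of_isClosed
        isClosed_sphere isClosed_Iic) inter_subset_left
  obtain ⟨v, hv, hvs, hvt⟩ := exists_contDiff_hasCompactSupport_forall_mem hK
    (t := fun x => {z | 1 < ⟪gradient p x, z⟫ ∧ ∀ i, x ∈ S i → 1 < ⟪w i, z⟫})
    (fun x _ => by
      have hhalf : ∀ g : EuclideanSpace ℝ (Fin (n + 1)), Convex ℝ {z | 1 < ⟪g, z⟫} := fun g =>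
        convex_halfSpace_gt (innerSL ℝ g).toLinearMap.isLinear 1
      simp only [ofPred_and, ofPred_forall]
      exact (hhalf _).inter (convex_iInter fun i => convex_iInter fun _ => hhalf _))
    (fun x hx => by
      have hfin : {g | ∃ i, x ∈ S i ∧ g = w i}.Finite := (finite_range w).subset <| by
        rintro _ ⟨i, -, rfl⟩
        exact mem_range_self i
      obtain ⟨c, hc⟩ := exists_forall_one_lt_inner (hfin.insert _) (hcond x hx)
      refine ⟨c, ?_⟩
      filter_upwards [eventually_all.2 (hScl x (hne x hx.1)),
        (hgrad.inner continuous_const).continuousAt.eventually_const_lt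
          (hc _ (mem_insert _ _))] with y hyS hyg _
      exact ⟨hyg, fun i hi => hc _ (Or.inr ⟨i, hyS i hi, rfl⟩)⟩)
  obtain ⟨H, hHc, hHb, hH0, hH1⟩ := exists_isotopy_of_increasesAlong hv hvs
    hp.continuous.continuousOn hptc (fun l hl x _ => hhom l hl x) hd hpthom one_ne_zero one_pos
    (fun y hy hle => ((hp.differentiable one_ne_zero) y).hasGradientAt.increasesAlong
      (hvt y ⟨hy, hle⟩).1)
    (fun y hy hle => increasesAlong_of_piecewise_linear (hSnhds y (hne y hy))
      (hScl y (hne y hy)) hlin (hvt y ⟨hy, hle⟩).2)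
  exact ⟨H, hHc.continuousOn, hHb, fun x _ => hH0 x, by rw [hV, hVt, hH1]⟩
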